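/- arXiv:1310.5256 — 9 statements merged into one kernel-verified Lean document; each statement's English description precedes it below -/
import Mathlib

section
/- Let y > 1 be fixed and let r(n) denote the unique positive solution t of t·(e^t + √y) = n·√y·log y. Then e^{r(n)} ~ (n·√y·log y)/(log n) as n → ∞, i.e. the quotient of the two sides tends to 1. -/
open Filter Topology

theorem tendsto_exp_mul_log_div_atTop {s c : ℝ} (hs : 0 < s) (hc : 0 < c) :
    Tendsto (fun t : ℝ => Real.exp t /
      (t * (Real.exp t + s) / Real.log (t * (Real.exp t + s) / c))) atTop (𝓝 1) := by
  have hexp : Tendsto (fun t : ℝ => 1 + s * Real.exp (-t)) atTop (𝓝 1) := by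
    simpa using (Real.tendsto_exp_neg_atTop_nhds_zero.const_mul s).const_add 1
  have hlog : Tendsto (fun t : ℝ => Real.log (1 + s * Real.exp (-t)) - Real.log c) atTop
      (𝓝 (Real.log 1 - Real.log c)) := (hexp.log one_ne_zero).sub_const _
  have hdiv : Tendsto (fun t : ℝ => Real.log t / t) atTop (𝓝 0) :=
    Real.isLittleO_log_id_atTop.tendsto_div_nhds_zero
  have hprod := (((hdiv.const_add 1).add (hlog.div_atTop tendsto_id)).mul
    (hexp.inv₀ one_ne_zero))
  simp only [add_zero, inv_one, mul_one, id] at hprod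
  refine hprod.congr' ?_
  filter_upwards [eventually_gt_atTop 0] with t ht
  have hu : 0 < 1 + s * Real.exp (-t) := by positivity
  have hfac : Real.exp t + s = Real.exp t * (1 + s * Real.exp (-t)) := by
    rw [Real.exp_neg]
    field_simp
  rw [hfac, Real.log_div (by positivity) hc.ne', Real.log_mul ht.ne' (by positivity),
    Real.log_mul (Real.exp_ne_zero t) hu.ne', Real.log_exp]
  have he := Real.exp_ne_zero t
  generalize Real.exp t = e at *
  generalize 1 + s * Real.exp (-t) = u at *
  rw [div_div_eq_mul_div]
  field_simp
  ring

theorem tendsto_atTop_of_mul_exp_add_eq {s c : ℝ} (hs : 0 < s) (hc : 0 < c) {r : ℕ → ℝ}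
    (hr : ∀ n : ℕ, 0 < n → 0 < r n ∧ r n * (Real.exp (r n) + s) = n * c) :
    Tendsto r atTop atTop := by
  refine tendsto_atTop.2 fun M => ?_
  have hn : Tendsto (fun n : ℕ => (n : ℝ) * c) atTop atTop :=
    tendsto_natCast_atTop_atTop.atTop_mul_const hc
  filter_upwards [eventually_gt_atTop 0, hn.eventually_gt_atTop (M * (Real.exp M + s))]
    with n hpos hlt
  obtain ⟨h₀, heq⟩ := hr n hpos
  by_contra! h
  have hle : r n * (Real.exp (r n) + s) ≤ M * (Real.exp M + s) := by
    have := h₀.trans h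
    gcongr
  linarith

/-- For fixed `y > 1`, the unique positive solution `r n` of
`t * (exp t + √y) = n * √y * log y` satisfies
`exp (r n) ~ (n * √y * log y) / log n` as `n → ∞`. -/
theorem exp_r_asymptotic (y : ℝ) (hy : 1 < y) (r : ℕ → ℝ)
    (hr : ∀ n : ℕ, 0 < n →
      0 < r n ∧ r n * (Real.exp (r n) + Real.sqrt y) = n * Real.sqrt y * Real.log y) :
    Filter.Tendsto
      (fun n : ℕ => Real.exp (r n) / ((n : ℝ) * Real.sqrt y * Real.log y / Real.log n))
      Filter.atTop (nhds 1) := by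
  have hs : 0 < Real.sqrt y := Real.sqrt_pos.2 (by linarith)
  have hc : 0 < Real.sqrt y * Real.log y := mul_pos hs (Real.log_pos hy)
  simp only [mul_assoc] at hr ⊢
  refine ((tendsto_exp_mul_log_div_atTop hs hc).comp
    (tendsto_atTop_of_mul_exp_add_eq hs hc hr)).congr' ?_
  filter_upwards [eventually_gt_atTop 0] with n hn
  simp only [Function.comp_apply]
  rw [(hr n hn).2, mul_div_cancel_right₀ _ hc.ne']
end

section
/- For every real number y > 1 and every nonnegative integer n, one has f_n(1/y) = (1/√(2π·log y)) · ∫_{−∞}^{∞} exp(−s²/(2·log y)) · (1 + √y·e^{is})^n ds, where the integral is over the real line and the integrand is complex valued. -/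
open MeasureTheory in
theorem integrable_gaussian_mul_cexp_pow {L : ℝ} (hL : 0 < L) (k : ℕ) :
    Integrable fun s : ℝ =>
      Complex.exp (-(s : ℂ) ^ 2 / (2 * L)) * Complex.exp (Complex.I * s) ^ k := by
  have hb : 0 < ((1 / (2 * L) : ℝ) : ℂ).re := by
    rw [Complex.ofReal_re]; positivity
  convert integrable_cexp_quadratic hb (Complex.I * k) 0 using 2 with s
  rw [← Complex.exp_nat_mul, ← Complex.exp_add]
  congr 1
  push_cast
  ring

theorem integral_gaussian_mul_cexp_pow {L : ℝ} (hL : 0 < L) (k : ℕ) :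
    ∫ s : ℝ, Complex.exp (-(s : ℂ) ^ 2 / (2 * L)) * Complex.exp (Complex.I * s) ^ k =
      (Real.sqrt (2 * Real.pi * L) * Real.exp (-(k : ℝ) ^ 2 * L / 2) : ℝ) := by
  have hb : 0 < ((1 / (2 * L) : ℝ) : ℂ).re := by
    rw [Complex.ofReal_re]; positivity
  have hLC : (L : ℂ) ≠ 0 := by exact_mod_cast hL.ne'
  have hsqrt : ((Real.pi : ℂ) / ((1 / (2 * L) : ℝ) : ℂ)) ^ (1 / 2 : ℂ) =
      (Real.sqrt (2 * Real.pi * L) : ℝ) := by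
    rw [Real.sqrt_eq_rpow, Complex.ofReal_cpow (by positivity)]
    congr 1
    · push_cast
      field_simp
    · push_cast
      rfl
  have h := fourierIntegral_gaussian hb (k : ℂ)
  rw [hsqrt] at h
  convert h using 1
  · congr 1 with s
    rw [← Complex.exp_nat_mul, mul_comm]
    congr 2 <;> push_cast <;> ring
  · push_cast
    congr 2
    field_simp
    norm_num

theorem sqrt_pow_mul_exp_neg_sq_mul_log {y : ℝ} (hy : 0 < y) (k : ℕ) :
    Real.sqrt y ^ k * Real.exp (-(k : ℝ) ^ 2 * Real.log y / 2) = (1 / y) ^ k.choose 2 := by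
  rw [one_div, ← Real.rpow_natCast (Real.sqrt y), Real.sqrt_eq_rpow, ← Real.rpow_mul hy.le,
    inv_pow, ← Real.rpow_natCast y, ← Real.rpow_neg hy.le, Real.rpow_def_of_pos hy,
    Real.rpow_def_of_pos hy, ← Real.exp_add, Nat.cast_choose_two]
  congr 1
  ring


/-- Integral representation: for `y > 1` and any nonnegative integer `n`,
`f_n (1/y) = (1/√(2π log y)) ∫_ℝ exp (−s²/(2 log y)) (1 + √y e^{is})^n ds`. -/
theorem fn_integral_representation (y : ℝ) (hy : 1 < y) (n : ℕ) :
    ((∑ k ∈ Finset.range (n + 1), (n.choose k : ℝ) * (1 / y) ^ (k.choose 2) : ℝ) : ℂ)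
      = (1 / Real.sqrt (2 * Real.pi * Real.log y) : ℝ) *
        ∫ s : ℝ, Complex.exp (-(s : ℂ) ^ 2 / (2 * Real.log y)) *
          (1 + Real.sqrt y * Complex.exp (Complex.I * s)) ^ n := by
  have hL : 0 < Real.log y := Real.log_pos hy
  have hs : Real.sqrt (2 * Real.pi * Real.log y) ≠ 0 := by positivity
  have hexpand (s : ℝ) : Complex.exp (-(s : ℂ) ^ 2 / (2 * Real.log y)) *
      (1 + Real.sqrt y * Complex.exp (Complex.I * s)) ^ n =
      ∑ k ∈ Finset.range (n + 1), ((n.choose k : ℂ) * (Real.sqrt y : ℂ) ^ k) *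
        (Complex.exp (-(s : ℂ) ^ 2 / (2 * Real.log y)) * Complex.exp (Complex.I * s) ^ k) := by
    rw [add_comm, add_pow, Finset.mul_sum]
    refine Finset.sum_congr rfl fun k _ => ?_
    rw [one_pow, mul_pow]
    ring
  simp_rw [hexpand]
  rw [MeasureTheory.integral_finsetSum _ fun k _ =>
    (integrable_gaussian_mul_cexp_pow hL k).const_mul _, Finset.mul_sum, Complex.ofReal_sum]
  refine Finset.sum_congr rfl fun k _ => ?_
  rw [MeasureTheory.integral_const_mul, integral_gaussian_mul_cexp_pow hL,
    ← sqrt_pow_mul_exp_neg_sq_mul_log (zero_lt_one.trans hy) k]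
  norm_cast
  field_simp
end

section
/- Let y > 1 be fixed. Then there exists an integer n₀ = n₀(y), depending only on y, such that for all n ≥ n₀ and all real s, |h_n(s)| ≤ exp(−(1 − cos 1)·s² + 1), where h_n is defined via r(n), a(n), b_ν(n) as in the context. -/
/-- Exponentials dominate powers: `k ^ m ≤ m! / 2 ^ m * 8 ^ k`. -/
theorem natCast_pow_le_factorial_mul_pow (k m : ℕ) :
    (k : ℝ) ^ m ≤ (m.factorial : ℝ) / 2 ^ m * 8 ^ k := by
  have h1 := Real.pow_div_factorial_le_exp (x := 2 * (k : ℝ)) (by positivity) m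
  have h2 : Real.exp (2 * (k : ℝ)) ≤ 8 ^ k := by
    rw [mul_comm, Real.exp_nat_mul]
    gcongr
    have h3 : Real.exp 2 = Real.exp 1 ^ 2 := by rw [← Real.exp_nat_mul]; norm_num
    rw [h3]
    nlinarith [Real.exp_one_lt_d9, Real.exp_pos 1]
  have hf : (0 : ℝ) < m.factorial := by positivity
  have h4 := (div_le_iff₀ hf).1 (h1.trans h2)
  rw [mul_pow] at h4
  rw [div_mul_eq_mul_div, le_div_iff₀ (by positivity)]
  linarith

/-- The power series `∑ k ^ m (-x) ^ k` is close to its first term when `x` is small. -/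
theorem norm_tsum_pow_mul_neg_pow_le {x : ℝ} (hx : 0 ≤ x) (hx' : x ≤ 1 / 16) (m : ℕ) :
    ‖∑' k : ℕ, ((k + 1 : ℕ) : ℂ) ^ m * (-(x : ℂ)) ^ (k + 1)‖ ≤
      x + (m.factorial : ℝ) / 2 ^ m * (256 * x ^ 2) := by
  set C : ℝ := (m.factorial : ℝ) / 2 ^ m
  have hC : 0 ≤ C := by positivity
  have hs : HasSum (fun k : ℕ => (if k = 0 then x else 0) + C * (128 * x ^ 2) * (1 / 2) ^ k)
      (x + C * (128 * x ^ 2) * 2) :=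
    (hasSum_ite_eq 0 x).add (hasSum_geometric_two.mul_left _)
  refine (tsum_of_norm_bounded hs fun k => ?_).trans (le_of_eq (by ring))
  rw [norm_mul, norm_pow, norm_pow, norm_neg, Complex.norm_natCast, Complex.norm_real,
    Real.norm_of_nonneg hx]
  rcases k with _ | k
  · simp only [zero_add, Nat.cast_one, one_pow, pow_one, if_true, pow_zero]
    have : 0 ≤ C * (128 * x ^ 2) := by positivity
    linarith
  · rw [if_neg (Nat.succ_ne_zero k), zero_add]
    calc ((k + 1 + 1 : ℕ) : ℝ) ^ m * x ^ (k + 1 + 1)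
        ≤ C * 8 ^ (k + 1 + 1) * x ^ (k + 1 + 1) := by
          gcongr
          exact natCast_pow_le_factorial_mul_pow _ _
      _ = C * (64 * x ^ 2) * (8 * x) ^ k := by ring
      _ ≤ C * (64 * x ^ 2) * (1 / 2) ^ k := by
          gcongr
          linarith
      _ = C * (128 * x ^ 2) * (1 / 2) ^ (k + 1) := by ring

/-- Bound on the coefficients of the exponent of `h_n`. -/
theorem norm_coefficient_le {x : ℝ} (hx : 0 ≤ x) (hx' : x ≤ 1 / 16) (n ν : ℕ) :
    ‖(-(n : ℂ) * Complex.I ^ (ν + 3) / ((ν + 3).factorial : ℂ)) *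
        ∑' k : ℕ, ((k + 1 : ℕ) : ℂ) ^ (ν + 2) * (-(x : ℂ)) ^ (k + 1)‖ ≤
      n * x / 6 * (1 / 4) ^ ν + n * (64 / 3 * x ^ 2) * (1 / 2) ^ ν := by
  rw [norm_mul, norm_div, norm_mul, norm_pow, Complex.norm_I, one_pow, mul_one, norm_neg,
    Complex.norm_natCast, Complex.norm_natCast]
  have hf : (6 : ℝ) * 4 ^ ν ≤ ((ν + 3).factorial : ℝ) := by
    have := Nat.factorial_mul_pow_le_factorial (m := 3) (n := ν)
    rw [add_comm 3 ν] at this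
    exact_mod_cast this
  have hf' : (3 : ℝ) * ((ν + 2).factorial : ℝ) ≤ ((ν + 3).factorial : ℝ) := by
    rw [Nat.factorial_succ (ν + 2)]
    push_cast
    gcongr
    linarith [(Nat.cast_nonneg ν : (0 : ℝ) ≤ ν)]
  have hF : (0 : ℝ) < ((ν + 3).factorial : ℝ) := by positivity
  have h1 : x / ((ν + 3).factorial : ℝ) ≤ x / 6 * (1 / 4) ^ ν := by
    calc x / ((ν + 3).factorial : ℝ) ≤ x / (6 * 4 ^ ν) := by gcongr
      _ = x / 6 * (1 / 4) ^ ν := by rw [one_div, inv_pow]; field_simp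
  have h2 : ((ν + 2).factorial : ℝ) / ((ν + 3).factorial : ℝ) ≤ 1 / 3 := by
    rw [div_le_div_iff₀ hF (by norm_num)]
    linarith
  calc _ ≤ (n : ℝ) / ((ν + 3).factorial : ℝ) *
        (x + ((ν + 2).factorial : ℝ) / 2 ^ (ν + 2) * (256 * x ^ 2)) := by
        gcongr
        exact norm_tsum_pow_mul_neg_pow_le hx hx' _
    _ = n * (x / ((ν + 3).factorial : ℝ)) +
        n * (((ν + 2).factorial : ℝ) / ((ν + 3).factorial : ℝ)) * (64 * x ^ 2) * (1 / 2) ^ ν := by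
        rw [one_div, inv_pow]
        field_simp
        ring
    _ ≤ n * (x / 6 * (1 / 4) ^ ν) + n * (1 / 3) * (64 * x ^ 2) * (1 / 2) ^ ν := by gcongr
    _ = _ := by ring

/-- A power series without terms of degree below three, with coefficients bounded by two geometric
sequences, is at most quadratic on `[-1, 1]`. -/
theorem norm_tsum_mul_pow_le {c : ℕ → ℂ} {A B t : ℝ} (ht : |t| ≤ 1)
    (hc : ∀ ν, ‖c ν‖ ≤ A * (1 / 4) ^ ν + B * (1 / 2) ^ ν) :
    ‖∑' ν : ℕ, c ν * (t : ℂ) ^ (ν + 3)‖ ≤ (4 / 3 * A + 2 * B) * t ^ 2 := by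
  have hg : HasSum (fun ν : ℕ => (1 / 4 : ℝ) ^ ν) (4 / 3) := by
    convert hasSum_geometric_of_lt_one (r := (1 / 4 : ℝ)) (by norm_num) (by norm_num) using 1
    norm_num
  have hs := ((hg.mul_left A).add (hasSum_geometric_two.mul_left B)).mul_right (t ^ 2)
  refine (tsum_of_norm_bounded hs fun ν => ?_).trans (le_of_eq (by ring))
  rw [norm_mul, norm_pow, Complex.norm_real, Real.norm_eq_abs, ← sq_abs t]
  exact mul_le_mul (hc ν) (pow_le_pow_of_le_one (abs_nonneg t) ht (by omega)) (by positivity)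
    ((norm_nonneg _).trans (hc ν))

/-- The saddle point tends to infinity, so `√y e ^ (-r n)` is eventually small. -/
theorem exists_forall_sqrt_mul_exp_neg_le {y : ℝ} (hy : 1 < y) {r : ℕ → ℝ}
    (hr : ∀ n : ℕ, 0 < n →
      0 < r n ∧ r n * (Real.exp (r n) + Real.sqrt y) = n * Real.sqrt y * Real.log y)
    {ε : ℝ} (hε : 0 < ε) :
    ∃ n₀ : ℕ, 0 < n₀ ∧ ∀ n : ℕ, n₀ ≤ n → Real.sqrt y * Real.exp (-(r n)) ≤ ε := by
  have hsy : 0 < Real.sqrt y := Real.sqrt_pos.2 (by linarith)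
  have hc : 0 < Real.sqrt y * Real.log y := mul_pos hsy (Real.log_pos hy)
  set R : ℝ := Real.log (Real.sqrt y / ε)
  obtain ⟨N, hN⟩ := exists_nat_gt (R * (Real.exp R + Real.sqrt y) / (Real.sqrt y * Real.log y))
  refine ⟨N + 1, N.succ_pos, fun n hn => ?_⟩
  obtain ⟨hrpos, hreq⟩ := hr n (by omega)
  have hlt : R < r n := by
    by_contra! hle
    have hNn : (N : ℝ) ≤ n := by exact_mod_cast (by omega : N ≤ n)
    have h1 := (div_lt_iff₀ hc).1 (hN.trans_le hNn)
    have h2 : r n * (Real.exp (r n) + Real.sqrt y) ≤ R * (Real.exp R + Real.sqrt y) := by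
      have := hrpos.trans_le hle
      gcongr
    linarith
  calc Real.sqrt y * Real.exp (-(r n)) ≤ Real.sqrt y * Real.exp (-R) := by gcongr
    _ = ε := by
      rw [Real.exp_neg, Real.exp_log (by positivity)]
      field_simp


/-- Uniform bound for `h_n`: there is `n₀ = n₀(y)` such that for all `n ≥ n₀` and all real `s`,
`|h_n(s)| ≤ exp(−(1 − cos 1) s² + 1)`. -/
theorem h_uniform_bound (y : ℝ) (hy : 1 < y) (r a : ℕ → ℝ) (b : ℕ → ℕ → ℂ) (h : ℕ → ℝ → ℂ)
    (hr : ∀ n : ℕ, 0 < n →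
      0 < r n ∧ r n * (Real.exp (r n) + Real.sqrt y) = n * Real.sqrt y * Real.log y)
    (ha : ∀ n : ℕ, a n = 1 / (2 * Real.log y) +
      n * Real.sqrt y * Real.exp (-(r n)) / (2 * (1 + Real.sqrt y * Real.exp (-(r n))) ^ 2))
    (hb : ∀ ν n : ℕ, 3 ≤ ν → b ν n =
      (-(n : ℂ) * Complex.I ^ ν / (ν.factorial : ℂ)) *
        ∑' k : ℕ, ((k + 1 : ℕ) : ℂ) ^ (ν - 1) * (-(Real.sqrt y * Real.exp (-(r n))) : ℂ) ^ (k + 1))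
    (hh : ∀ (n : ℕ) (s : ℝ), h n s =
      if s ∈ Set.Icc (-Real.sqrt (a n)) (Real.sqrt (a n)) then
        Complex.exp (-(s : ℂ) ^ 2 +
          ∑' ν : ℕ, b (ν + 3) n * ((s / Real.sqrt (a n) : ℝ) : ℂ) ^ (ν + 3))
      else 0) :
    ∃ n₀ : ℕ, ∀ n : ℕ, n₀ ≤ n → ∀ s : ℝ,
      ‖h n s‖ ≤ Real.exp (-(1 - Real.cos 1) * s ^ 2 + 1) := by
  obtain ⟨n₀, hn₀, hsmall⟩ := exists_forall_sqrt_mul_exp_neg_le hy hr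
    (ε := 1 / 10000) (by norm_num)
  refine ⟨n₀, fun n hn s => ?_⟩
  rw [hh]
  split_ifs with hs
  swap
  · rw [norm_zero]
    positivity
  have hxle := hsmall n hn
  have hx : 0 < Real.sqrt y * Real.exp (-(r n)) :=
    mul_pos (Real.sqrt_pos.2 (by linarith)) (Real.exp_pos _)
  have han := ha n
  have hb' : ∀ ν, b (ν + 3) n = (-(n : ℂ) * Complex.I ^ (ν + 3) / ((ν + 3).factorial : ℂ)) *
      ∑' k : ℕ, ((k + 1 : ℕ) : ℂ) ^ (ν + 2) *
        (-((Real.sqrt y * Real.exp (-(r n)) : ℝ) : ℂ)) ^ (k + 1) := by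
    intro ν
    rw [hb (ν + 3) n (by omega), Complex.ofReal_mul]
    rfl
  rw [mul_assoc] at han
  generalize Real.sqrt y * Real.exp (-(r n)) = x at *
  have hn0 : (0 : ℝ) < n := by exact_mod_cast (by omega : 0 < n)
  have hlog := Real.log_pos hy
  have hage : n * x * (249 / 500) ≤ a n := by
    have h1 : 0 ≤ 1 / (2 * Real.log y) := by positivity
    have h2 : n * x * (249 / 500) ≤ n * x / (2 * (1 + x) ^ 2) := by
      rw [le_div_iff₀ (by positivity), mul_assoc]
      refine mul_le_of_le_one_right (by positivity) ?_
      nlinarith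
    linarith
  have hnx : 0 < n * x := by positivity
  have hapos : 0 < a n := by linarith
  have hsq : 0 < Real.sqrt (a n) := Real.sqrt_pos.2 hapos
  have ht : |s / Real.sqrt (a n)| ≤ 1 := by
    rw [abs_div, abs_of_pos hsq, div_le_one hsq]
    exact abs_le.2 hs
  have ht2 : (s / Real.sqrt (a n)) ^ 2 = s ^ 2 / a n := by
    rw [div_pow, Real.sq_sqrt hapos.le]
  have hT := norm_tsum_mul_pow_le ht fun ν =>
    (congrArg norm (hb' ν)).trans_le (norm_coefficient_le hx.le (by linarith) n ν)
  have hcos : 1 / 2 ≤ Real.cos 1 := by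
    have := Real.one_sub_sq_div_two_le_cos (x := 1)
    linarith
  have hbound : (4 / 3 * (n * x / 6) + 2 * (n * (64 / 3 * x ^ 2))) * (s / Real.sqrt (a n)) ^ 2 ≤
      Real.cos 1 * s ^ 2 := by
    have h1 : 4 / 3 * (n * x / 6) + 2 * (n * (64 / 3 * x ^ 2)) ≤ 1 / 2 * a n := by
      nlinarith [mul_le_mul_of_nonneg_left hxle hnx.le]
    calc _ ≤ 1 / 2 * a n * (s ^ 2 / a n) := by
          rw [ht2]
          gcongr
      _ = 1 / 2 * s ^ 2 := by field_simp
      _ ≤ _ := by gcongr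
  rw [Complex.norm_exp]
  refine Real.exp_le_exp.2 ?_
  rw [Complex.add_re, Complex.neg_re, ← Complex.ofReal_pow, Complex.ofReal_re]
  have hre := (Complex.re_le_norm _).trans (hT.trans hbound)
  linarith
end

section
/- Let y > 1 be fixed and let r(n) denote the unique positive solution t of t·(e^t + √y) = n·√y·log y, with a(n) = 1/(2·log y) + n·√y·e^{−r(n)}/(2·(1 + √y·e^{−r(n)})²). Then 2·a(n)·log y = 1 + r(n)/(1 + √y·e^{−r(n)}), and consequently 2·a(n)·log y ~ r(n) as n → ∞. -/
/-- If `r n` solves `t (e ^ t + s) = u n` with `s > 0` and `u → ∞`, then `r → ∞`. -/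
theorem tendsto_atTop_of_mul_exp_add_eq_s14 {r u : ℕ → ℝ} {s : ℝ} (hs : 0 < s)
    (hr : ∀ n : ℕ, 0 < n → 0 < r n ∧ r n * (Real.exp (r n) + s) = u n)
    (hu : Filter.Tendsto u Filter.atTop Filter.atTop) :
    Filter.Tendsto r Filter.atTop Filter.atTop := by
  refine Filter.tendsto_atTop.2 fun M => ?_
  filter_upwards [hu.eventually_gt_atTop (M * (Real.exp M + s)), Filter.eventually_gt_atTop 0]
    with n hn hpos
  obtain ⟨h0, h⟩ := hr n hpos
  by_contra! hlt
  have hexp : Real.exp (r n) ≤ Real.exp M := Real.exp_le_exp.2 hlt.le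
  have hle : r n * (Real.exp (r n) + s) ≤ M * (Real.exp M + s) :=
    mul_le_mul hlt.le (by linarith) (by positivity) (by linarith)
  linarith

/-- The identity `2 a(n) log y = 1 + r(n)/(1 + √y e^{−r(n)})` and the consequence
`2 a(n) log y ~ r(n)` as `n → ∞`. -/
theorem two_a_log_y_identity_and_asymptotic (y : ℝ) (hy : 1 < y) (r a : ℕ → ℝ)
    (hr : ∀ n : ℕ, 0 < n →
      0 < r n ∧ r n * (Real.exp (r n) + Real.sqrt y) = n * Real.sqrt y * Real.log y)
    (ha : ∀ n : ℕ, a n = 1 / (2 * Real.log y) +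
      n * Real.sqrt y * Real.exp (-(r n)) / (2 * (1 + Real.sqrt y * Real.exp (-(r n))) ^ 2)) :
    (∀ n : ℕ, 0 < n →
      2 * a n * Real.log y = 1 + r n / (1 + Real.sqrt y * Real.exp (-(r n)))) ∧
    Filter.Tendsto (fun n : ℕ => 2 * a n * Real.log y / r n) Filter.atTop (nhds 1) := by
  have hs : 0 < Real.sqrt y := Real.sqrt_pos.2 (by linarith)
  have hL : 0 < Real.log y := Real.log_pos hy
  have key : ∀ n : ℕ, 0 < n →
      2 * a n * Real.log y = 1 + r n / (1 + Real.sqrt y * Real.exp (-(r n))) := by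
    intro n hn
    obtain ⟨-, h⟩ := hr n hn
    have hD : 0 < 1 + Real.sqrt y * Real.exp (-(r n)) := by positivity
    have hE : Real.exp (r n) * Real.exp (-(r n)) = 1 := by
      rw [← Real.exp_add, add_neg_cancel, Real.exp_zero]
    have h' : n * Real.sqrt y * Real.exp (-(r n)) * Real.log y =
        r n * (1 + Real.sqrt y * Real.exp (-(r n))) := by
      linear_combination (-Real.exp (-(r n))) * h + r n * hE
    rw [ha n]
    generalize 1 + Real.sqrt y * Real.exp (-(r n)) = D at hD h'
    generalize n * Real.sqrt y * Real.exp (-(r n)) = N at h'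
    field_simp
    linear_combination h'
  refine ⟨key, ?_⟩
  have hrtop : Filter.Tendsto r Filter.atTop Filter.atTop := by
    refine tendsto_atTop_of_mul_exp_add_eq_s14 hs hr ?_
    exact (tendsto_natCast_atTop_atTop.atTop_mul_const hs).atTop_mul_const hL
  have hexp : Filter.Tendsto (fun n => Real.exp (-(r n))) Filter.atTop (nhds 0) :=
    Real.tendsto_exp_neg_atTop_nhds_zero.comp hrtop
  have hlim : Filter.Tendsto
      (fun n => (r n)⁻¹ + (1 + Real.sqrt y * Real.exp (-(r n)))⁻¹) Filter.atTop (nhds 1) := by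
    simpa using hrtop.inv_tendsto_atTop.add
      (((hexp.const_mul (Real.sqrt y)).const_add 1).inv₀ (by simp))
  refine hlim.congr' ?_
  filter_upwards [Filter.eventually_gt_atTop 0] with n hn
  have h0 : 0 < r n := (hr n hn).1
  have hD : 0 < 1 + Real.sqrt y * Real.exp (-(r n)) := by positivity
  rw [key n hn]
  field_simp
end

section
/- Let y > 1 be fixed and let r(n) denote the unique positive solution t of t·(e^t + √y) = n·√y·log y. Then r(n)²/(2·log y) + n·log(1 + √y·e^{−r(n)}) − (r(n)² + 2·r(n))/(2·log y) = O((log n)²/n) as n → ∞; equivalently, n·(log(1 + √y·e^{−r(n)}) − √y·e^{−r(n)}/(1 + √y·e^{−r(n)})) = O((log n)²/n). -/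
/-- The remainder `log (1 + u) - u / (1 + u)` is nonnegative and at most `(u / (1 + u))² (1 + u)`. -/
theorem log_one_add_sub_div_bounds {u : ℝ} (hu : 0 < u) :
    0 ≤ Real.log (1 + u) - u / (1 + u) ∧
      Real.log (1 + u) - u / (1 + u) ≤ (u / (1 + u)) ^ 2 * (1 + u) := by
  have h1 : 0 < 1 + u := by linarith
  have hlow := Real.one_sub_inv_le_log_of_pos h1
  have hupp := Real.log_le_sub_one_of_pos h1
  have e1 : 1 - (1 + u)⁻¹ = u / (1 + u) := by field_simp; ring
  have e2 : (u / (1 + u)) ^ 2 * (1 + u) = u - u / (1 + u) := by field_simp; ring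
  constructor
  · linarith
  · rw [e2]; linarith

/-- A solution of `t (e ^ t + s) = x c` grows at most logarithmically in `x`. -/
theorem le_mul_log_of_mul_exp_add_eq {t s c x : ℝ} (ht : 0 < t) (hs : 0 < s) (hc : 0 < c)
    (hx : Real.exp 1 ≤ x) (h : t * (Real.exp t + s) = x * c) :
    t ≤ (1 + |Real.log c|) * Real.log x := by
  have hx0 : 0 < x := (Real.exp_pos 1).trans_le hx
  have hlog : 1 ≤ Real.log x := (Real.le_log_iff_exp_le hx0).2 hx
  have habs := abs_nonneg (Real.log c)
  rcases le_total t 1 with h1 | h1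
  · nlinarith
  · have hexp : Real.exp t ≤ x * c := by
      nlinarith [Real.exp_pos t]
    have ht' : t ≤ Real.log (x * c) := (Real.le_log_iff_exp_le (by positivity)).2 hexp
    rw [Real.log_mul hx0.ne' hc.ne'] at ht'
    nlinarith [le_abs_self (Real.log c)]


/-- `ψ_n(0) − (r(n)² + 2 r(n))/(2 log y) = O((log n)²/n)`, equivalently
`n (log(1 + √y e^{−r(n)}) − √y e^{−r(n)}/(1 + √y e^{−r(n)})) = O((log n)²/n)`. -/
theorem psi_zero_minus_main_term_bigO (y : ℝ) (hy : 1 < y) (r : ℕ → ℝ)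
    (hr : ∀ n : ℕ, 0 < n →
      0 < r n ∧ r n * (Real.exp (r n) + Real.sqrt y) = n * Real.sqrt y * Real.log y) :
    (fun n : ℕ => (r n) ^ 2 / (2 * Real.log y) +
        n * Real.log (1 + Real.sqrt y * Real.exp (-(r n))) -
        ((r n) ^ 2 + 2 * r n) / (2 * Real.log y))
      =O[Filter.atTop] (fun n : ℕ => (Real.log n) ^ 2 / n) ∧
    (fun n : ℕ => (n : ℝ) * (Real.log (1 + Real.sqrt y * Real.exp (-(r n))) -
        Real.sqrt y * Real.exp (-(r n)) / (1 + Real.sqrt y * Real.exp (-(r n)))))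
      =O[Filter.atTop] (fun n : ℕ => (Real.log n) ^ 2 / n) := by
  have hs : 0 < Real.sqrt y := Real.sqrt_pos.2 (by linarith)
  have hL : 0 < Real.log y := Real.log_pos hy
  have key : ∀ n : ℕ, 0 < n →
      (n : ℝ) * (Real.sqrt y * Real.exp (-(r n)) / (1 + Real.sqrt y * Real.exp (-(r n)))) =
        r n / Real.log y := by
    intro n hn
    have h := (hr n hn).2
    have he := Real.exp_pos (r n)
    rw [Real.exp_neg]
    field_simp
    linarith
  have hbound : (fun n : ℕ => (n : ℝ) * (Real.log (1 + Real.sqrt y * Real.exp (-(r n))) -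
        Real.sqrt y * Real.exp (-(r n)) / (1 + Real.sqrt y * Real.exp (-(r n)))))
      =O[Filter.atTop] (fun n : ℕ => (Real.log n) ^ 2 / n) := by
    refine Asymptotics.IsBigO.of_bound
      (((1 + |Real.log (Real.sqrt y * Real.log y)|) / Real.log y) ^ 2 * (1 + Real.sqrt y)) ?_
    filter_upwards [Filter.eventually_ge_atTop 3] with n hn
    have hn0 : 0 < n := by omega
    have hnR : (0 : ℝ) < n := by exact_mod_cast hn0
    have hn3 : (3 : ℝ) ≤ n := by exact_mod_cast hn
    obtain ⟨hrpos, hreq⟩ := hr n hn0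
    have hrle := le_mul_log_of_mul_exp_add_eq hrpos hs (mul_pos hs hL)
      (by linarith [Real.exp_one_lt_d9]) (hreq.trans (mul_assoc _ _ _))
    have hk := key n hn0
    have hule : Real.sqrt y * Real.exp (-(r n)) ≤ Real.sqrt y :=
      mul_le_of_le_one_right hs.le (Real.exp_le_one_iff.2 (by linarith))
    have hupos : 0 < Real.sqrt y * Real.exp (-(r n)) := by positivity
    set u := Real.sqrt y * Real.exp (-(r n))
    obtain ⟨h0, h1⟩ := log_one_add_sub_div_bounds hupos
    have hu : u / (1 + u) = r n / Real.log y / n := by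
      rw [← hk]; field_simp
    rw [Real.norm_of_nonneg (mul_nonneg hnR.le h0), Real.norm_of_nonneg (by positivity)]
    calc (n : ℝ) * (Real.log (1 + u) - u / (1 + u))
        ≤ n * ((r n / Real.log y / n) ^ 2 * (1 + Real.sqrt y)) := by
          rw [← hu]
          refine mul_le_mul_of_nonneg_left (h1.trans ?_) hnR.le
          gcongr
      _ ≤ n * (((1 + |Real.log (Real.sqrt y * Real.log y)|) * Real.log n / Real.log y / n) ^ 2 *
            (1 + Real.sqrt y)) := by
          gcongr
      _ = _ := by
          field_simp
  refine ⟨hbound.congr' ?_ Filter.EventuallyEq.rfl, hbound⟩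
  filter_upwards [Filter.eventually_gt_atTop 0] with n hn
  rw [mul_sub, key n hn]
  field_simp
  ring
end

section
/- For a fixed real number y > 1, as n → ∞ one has f_n(1/y) = (1/√r(n)) · exp((r(n)² + 2·r(n))/(2·log y)) · (Θ(n) + o(1)), where Θ(n) = 1 + 2·Σ_{k=1}^{∞} exp(−2π²k²/log y)·cos(2πk·r(n)/log y); i.e. the quantity f_n(1/y)·√r(n)·exp(−(r(n)² + 2·r(n))/(2·log y)) − Θ(n) tends to 0 as n → ∞. -/
open Filter Topology Real

/-- Poisson summation for a shifted Gaussian, in cosine-series form. -/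
theorem one_add_two_mul_tsum_exp_mul_cos {L : ℝ} (hL : 0 < L) (c : ℝ) :
    1 + 2 * ∑' k : ℕ, exp (-2 * π ^ 2 * ((k : ℝ) + 1) ^ 2 / L) *
        cos (2 * π * ((k : ℝ) + 1) * c / L) =
      √(L / (2 * π)) * ∑' m : ℤ, exp (-(L / 2 * (m - c / L) ^ 2)) := by
  have hLc : (L : ℂ) ≠ 0 := by exact_mod_cast hL.ne'
  have hπc : (π : ℂ) ≠ 0 := by exact_mod_cast pi_ne_zero
  set f : ℤ → ℂ := fun n =>
    Complex.exp (-π * ((2 * π / L : ℝ) : ℂ) * n ^ 2 + 2 * π * (Complex.I * (c / L : ℝ)) * n)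
    with hf
  have hfs : Summable f := by
    have h := (summable_jacobiTheta₂_term_iff ((c / L : ℝ) : ℂ)
      (Complex.I * (2 * π / L : ℝ))).2 (by
        simp only [Complex.mul_im, Complex.I_re, Complex.I_im, Complex.ofReal_re,
          Complex.ofReal_im]
        simp only [zero_mul, one_mul, zero_add]
        positivity)
    refine h.congr fun n => ?_
    rw [jacobiTheta₂_term, hf]
    congr 1
    linear_combination (π * n ^ 2 * ((2 * π / L : ℝ) : ℂ)) * Complex.I_mul_I
  have hinj : Function.Injective (fun n : ℕ => ((n : ℤ) + 1)) := fun a b h => by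
    simpa using h
  have hinj' : Function.Injective (fun n : ℕ => (-((n : ℤ) + 1))) := fun a b h => by
    simpa using h
  have h1 : Summable fun n : ℕ => f ((n : ℤ) + 1) := hfs.comp_injective hinj
  have h2 : Summable fun n : ℕ => f (-((n : ℤ) + 1)) := hfs.comp_injective hinj'
  have hpair : ∀ n : ℕ, f ((n : ℤ) + 1) + f (-((n : ℤ) + 1)) =
      ((2 * (exp (-2 * π ^ 2 * ((n : ℝ) + 1) ^ 2 / L) *
        cos (2 * π * ((n : ℝ) + 1) * c / L)) : ℝ) : ℂ) := fun n => by
    have e1 : f ((n : ℤ) + 1) = Complex.exp ((-2 * π ^ 2 * ((n : ℝ) + 1) ^ 2 / L : ℝ) : ℂ) *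
        Complex.exp (((2 * π * ((n : ℝ) + 1) * c / L : ℝ) : ℂ) * Complex.I) := by
      rw [hf, ← Complex.exp_add]
      push_cast
      congr 1
      field_simp
    have e2 : f (-((n : ℤ) + 1)) = Complex.exp ((-2 * π ^ 2 * ((n : ℝ) + 1) ^ 2 / L : ℝ) : ℂ) *
        Complex.exp (-((2 * π * ((n : ℝ) + 1) * c / L : ℝ) : ℂ) * Complex.I) := by
      rw [hf, ← Complex.exp_add]
      push_cast
      congr 1
      field_simp
    rw [e1, e2, ← mul_add, ← Complex.two_cos, Complex.ofReal_mul, Complex.ofReal_mul,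
      Complex.ofReal_exp, Complex.ofReal_cos]
    push_cast
    ring
  have hsum : ∑' n : ℤ, f n = ((1 + 2 * ∑' k : ℕ, exp (-2 * π ^ 2 * ((k : ℝ) + 1) ^ 2 / L) *
        cos (2 * π * ((k : ℝ) + 1) * c / L) : ℝ) : ℂ) := by
    rw [tsum_of_add_one_of_neg_add_one h1 h2, add_right_comm, ← h1.tsum_add h2,
      tsum_congr hpair, ← Complex.ofReal_tsum, tsum_mul_left]
    simp [hf, add_comm]
  have hpois := Complex.tsum_exp_neg_quadratic (a := ((2 * π / L : ℝ) : ℂ))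
    (by rw [Complex.ofReal_re]; positivity) (Complex.I * (c / L : ℝ))
  apply Complex.ofReal_injective
  rw [← hsum, hf, hpois, Complex.ofReal_mul, Complex.ofReal_tsum]
  congr 1
  · have : (1 / 2 : ℂ) = ((1 / 2 : ℝ) : ℂ) := by push_cast; rfl
    rw [this, ← Complex.ofReal_cpow (by positivity), ← sqrt_eq_rpow,
      ← inv_div (2 * π) L, sqrt_inv, one_div, Complex.ofReal_inv]
  · refine tsum_congr fun m => ?_
    rw [← mul_assoc, Complex.I_mul_I, Complex.ofReal_exp]
    push_cast
    congr 1
    field_simp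
    ring

/-- The ratio of Stirling's approximation (with `k + 1` in place of `2πk` under the root)
to the factorial. -/
noncomputable def stirlingRatio (k : ℕ) : ℝ := ((k : ℝ) / exp 1) ^ k * √(k + 1) / k.factorial

theorem stirlingRatio_nonneg (k : ℕ) : 0 ≤ stirlingRatio k := by
  unfold stirlingRatio; positivity

theorem stirlingRatio_le_one (k : ℕ) : stirlingRatio k ≤ 1 := by
  rw [stirlingRatio, div_le_one (by positivity)]
  rcases Nat.eq_zero_or_pos k with rfl | hk
  · simp
  · refine le_trans ?_ (Stirling.le_factorial_stirling k)
    rw [mul_comm]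
    have h1 : (1 : ℝ) ≤ k := by exact_mod_cast hk
    gcongr
    nlinarith [pi_gt_three]

theorem tendsto_stirlingRatio : Tendsto stirlingRatio atTop (𝓝 (1 / √(2 * π))) := by
  have hone : Tendsto (fun k : ℕ => 1 + (k : ℝ)⁻¹) atTop (𝓝 (1 + 0)) :=
    tendsto_const_nhds.add tendsto_inv_atTop_nhds_zero_nat
  have h := ((hone.div_const 2).sqrt).div Stirling.tendsto_stirlingSeq_sqrt_pi (by positivity)
  have hlim : √((1 + 0) / 2) / √π = 1 / √(2 * π) := by
    rw [← sqrt_div (by norm_num), one_div, ← sqrt_inv]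
    congr 1
    field_simp
    norm_num
  rw [hlim] at h
  refine h.congr' ?_
  filter_upwards [eventually_ge_atTop 1] with k hk
  have hk0 : (0 : ℝ) < k := by exact_mod_cast hk
  have e : (1 + (k : ℝ)⁻¹) / 2 = (k + 1) / (2 * k) := by field_simp
  simp only [Pi.div_apply]
  rw [e, sqrt_div (by positivity), Stirling.stirlingSeq, stirlingRatio]
  field_simp

/-- The ratio of the falling factorial `n (n - 1) ⋯ (n - k + 1)` to `n ^ k`. -/
noncomputable def fallingRatio (n k : ℕ) : ℝ := n.choose k * k.factorial / (n : ℝ) ^ k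

theorem fallingRatio_nonneg (n k : ℕ) : 0 ≤ fallingRatio n k := by
  unfold fallingRatio; positivity

theorem fallingRatio_eq (n k : ℕ) : fallingRatio n k = n.descFactorial k / (n : ℝ) ^ k := by
  rw [fallingRatio, Nat.descFactorial_eq_factorial_mul_choose]
  push_cast
  ring

theorem fallingRatio_le_one {n : ℕ} (hn : 0 < n) (k : ℕ) : fallingRatio n k ≤ 1 := by
  rw [fallingRatio_eq, div_le_one (by positivity)]
  exact_mod_cast Nat.descFactorial_le_pow n k

theorem one_sub_sq_div_le_fallingRatio {n : ℕ} (hn : 0 < n) (k : ℕ) :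
    1 - (k : ℝ) ^ 2 / n ≤ fallingRatio n k := by
  have hn' : (0 : ℝ) < n := by exact_mod_cast hn
  rcases le_or_gt k n with hk | hk
  · have hkn : (k : ℝ) ≤ n := by exact_mod_cast hk
    have h1 : 1 + (k : ℝ) * (-(k / n)) ≤ (1 + -(k / n)) ^ k :=
      one_add_mul_le_pow (by
        have : (k : ℝ) / n ≤ 1 := (div_le_one hn').2 hkn
        linarith) k
    have h2 : ((n : ℝ) - k) ^ k ≤ n.descFactorial k := by
      have := Nat.pow_sub_le_descFactorial n k
      have h3 : (n - k) ^ k ≤ n.descFactorial k :=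
        le_trans (Nat.pow_le_pow_left (by omega) k) this
      rw [← Nat.cast_sub hk]
      exact_mod_cast h3
    calc 1 - (k : ℝ) ^ 2 / n = 1 + (k : ℝ) * (-(k / n)) := by ring
      _ ≤ (1 + -(k / n)) ^ k := h1
      _ = ((n : ℝ) - k) ^ k / (n : ℝ) ^ k := by rw [← div_pow]; congr 1; field_simp; ring
      _ ≤ fallingRatio n k := by rw [fallingRatio_eq]; gcongr
  · have : (1 : ℝ) ≤ (k : ℝ) ^ 2 / n := by
      rw [le_div_iff₀ hn']
      have h1 : (n : ℝ) ≤ k := by exact_mod_cast hk.le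
      have h2 : (1 : ℝ) ≤ k := by exact_mod_cast (by omega : 1 ≤ k)
      nlinarith
    linarith [fallingRatio_nonneg n k]

/-- The `k`-th term of the sum, normalised by the predicted growth factor. -/
noncomputable def scaledTerm (L r : ℝ) (n k : ℕ) : ℝ :=
  n.choose k * exp (-(L * (k * (k - 1) / 2))) * (√r * exp (-(r ^ 2 + 2 * r) / (2 * L)))

/-- The relative error in replacing `r (e ^ r + e ^ (L / 2))` by `r e ^ r`, on a log scale. -/
noncomputable def logCorrection (L r : ℝ) : ℝ := log (1 + exp (L / 2 - r))

theorem logCorrection_nonneg (L r : ℝ) : 0 ≤ logCorrection L r :=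
  log_nonneg (by linarith [exp_pos (L / 2 - r)])

theorem logCorrection_le (L r : ℝ) : logCorrection L r ≤ exp (L / 2 - r) := by
  have := log_le_sub_one_of_pos (show 0 < 1 + exp (L / 2 - r) by positivity)
  unfold logCorrection
  linarith

theorem eq_mul_exp_of_saddle_eq {L r x : ℝ} (hL : 0 < L)
    (h : r * (exp r + exp (L / 2)) = x * exp (L / 2) * L) :
    x = r / L * exp (r - L / 2 + logCorrection L r) := by
  rw [exp_add, logCorrection, exp_log (by positivity), mul_add, mul_one, ← exp_add]
  have e1 : exp r = exp (r - L / 2) * exp (L / 2) := by rw [← exp_add]; congr 1; ring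
  have e2 : r - L / 2 + (L / 2 - r) = 0 := by ring
  rw [e2, exp_zero]
  rw [e1] at h
  have hpos := exp_pos (L / 2)
  have h' : r * (exp (r - L / 2) + 1) = x * L := by
    apply mul_right_cancel₀ hpos.ne'
    linear_combination h
  rw [div_mul_eq_mul_div, eq_div_iff hL.ne']
  linear_combination -h'

theorem scaledTerm_eq {L r : ℝ} {n : ℕ} (hL : 0 < L) (hr : 0 < r)
    (h : r * (exp r + exp (L / 2)) = n * exp (L / 2) * L) (k : ℕ) :
    scaledTerm L r n k = fallingRatio n k * stirlingRatio k * √(r / (k + 1)) *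
      exp (k * logCorrection L r) * exp (-(k * log (k / (r / L)) - (k - r / L))) *
      exp (-(L / 2 * (k - r / L) ^ 2)) := by
  have hn := eq_mul_exp_of_saddle_eq hL h
  set d := logCorrection L r
  have hnk : (n : ℝ) ^ k = (r / L) ^ k * exp (k * (r - L / 2 + d)) := by
    rw [hn, mul_pow, ← exp_nat_mul]
  have hkk : ((k : ℝ) / exp 1) ^ k = (r / L) ^ k * exp (k * log (k / (r / L)) - k) := by
    rcases Nat.eq_zero_or_pos k with rfl | hk
    · simp
    · have hk' : (0 : ℝ) < k := by exact_mod_cast hk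
      have : exp (k * log (k / (r / L)) - k) = (k / (r / L) / exp 1) ^ k := by
        rw [← exp_log (show 0 < k / (r / L) / exp 1 by positivity), ← exp_nat_mul,
          log_div (show k / (r / L) ≠ 0 by positivity) (exp_ne_zero 1), log_exp]
        congr 1
        ring
      rw [this, ← mul_pow]
      congr 1
      field_simp
  have hexp : exp (k * log (k / (r / L)) - k) * exp (k * d) *
      exp (-(k * log (k / (r / L)) - (k - r / L))) * exp (-(L / 2 * (k - r / L) ^ 2)) =
      exp (-(L * (k * (k - 1) / 2))) * exp (-(r ^ 2 + 2 * r) / (2 * L)) *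
        exp (k * (r - L / 2 + d)) := by
    simp only [← exp_add]
    congr 1
    field_simp
    ring
  rw [scaledTerm, fallingRatio, stirlingRatio, hnk, hkk, sqrt_div hr.le]
  have hrk : 0 < (r / L) ^ k := by positivity
  calc _ = n.choose k * √r * (exp (-(L * (k * (k - 1) / 2))) *
        exp (-(r ^ 2 + 2 * r) / (2 * L)) * exp (k * (r - L / 2 + d))) /
        exp (k * (r - L / 2 + d)) := by
        field_simp
    _ = _ := by
        rw [← hexp]
        generalize exp (k * (r - L / 2 + d)) = E1 at *
        generalize exp (k * log (k / (r / L)) - k) = E2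
        generalize exp (-(k * log (k / (r / L)) - (k - r / L))) = E3
        generalize exp (-(L / 2 * (k - r / L) ^ 2)) = E4
        generalize exp (k * d) = E5
        generalize (r / L) ^ k = E6 at *
        field_simp

theorem sub_le_mul_log_div {a c : ℝ} (ha : 0 ≤ a) (hc : 0 < c) : a - c ≤ a * log (a / c) := by
  rcases ha.eq_or_lt with rfl | ha
  · simpa using hc.le
  · have h := one_sub_inv_le_log_of_pos (div_pos ha hc)
    calc a - c = a * (1 - (a / c)⁻¹) := by field_simp
      _ ≤ a * log (a / c) := by gcongr

theorem mul_log_div_sub_le {a c : ℝ} (ha : 0 < a) (hc : 0 < c) :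
    a * log (a / c) - (a - c) ≤ (a - c) ^ 2 / c := by
  have h := log_le_sub_one_of_pos (div_pos ha hc)
  calc a * log (a / c) - (a - c) ≤ a * (a / c - 1) - (a - c) := by gcongr
    _ = (a - c) ^ 2 / c := by field_simp

theorem logCorrection_le_exp_half {L r : ℝ} (hr : 0 < r) : logCorrection L r ≤ exp (L / 2) :=
  (logCorrection_le L r).trans (exp_le_exp.2 (by linarith))

theorem mul_logCorrection_le (L r : ℝ) : r * logCorrection L r ≤ exp (L / 2) := by
  have h1 : r ≤ exp r := by linarith [add_one_le_exp r]
  calc r * logCorrection L r ≤ exp r * exp (L / 2 - r) :=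
        mul_le_mul h1 (logCorrection_le L r) (logCorrection_nonneg L r) (exp_pos r).le
    _ = exp (L / 2) := by rw [← exp_add]; congr 1; ring

theorem scaledTerm_nonneg (L r : ℝ) (n k : ℕ) : 0 ≤ scaledTerm L r n k := by
  unfold scaledTerm; positivity

theorem mul_abs_sub_mul_sq_le {L : ℝ} (hL : 0 < L) (b x : ℝ) :
    b * |x| - L / 2 * x ^ 2 ≤ b ^ 2 / (2 * L) := by
  rw [le_div_iff₀ (by positivity), ← sq_abs x]
  nlinarith [sq_nonneg (b - L * |x|)]

theorem scaledTerm_le {L r : ℝ} {n : ℕ} (hn : 0 < n) (hL : 0 < L) (hr : 0 < r)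
    (h : r * (exp r + exp (L / 2)) = n * exp (L / 2) * L) (k : ℕ) :
    scaledTerm L r n k ≤ √L * exp (exp (L / 2) / L + (2 + exp (L / 2)) ^ 2 / (2 * L)) *
      exp (-|k - r / L|) := by
  set s := exp (L / 2)
  set x : ℝ := k - r / L with hx
  have hk : (0 : ℝ) ≤ k := Nat.cast_nonneg k
  have hroot : √(r / (k + 1)) ≤ √L * exp |x| := by
    rw [← sqrt_sq (exp_pos |x|).le, ← sqrt_mul hL.le]
    apply sqrt_le_sqrt
    rw [div_le_iff₀ (by positivity), ← exp_nat_mul]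
    have h1 : r = L * (k - x) := by rw [hx]; field_simp; ring
    have h2 : -x ≤ |x| := neg_le_abs x
    have h3 : 2 * |x| + 1 ≤ exp ((2 : ℕ) * |x|) := by
      have := add_one_le_exp ((2 : ℕ) * |x|)
      push_cast at this ⊢
      exact this
    have h4 := abs_nonneg x
    calc r = L * (k - x) := h1
      _ ≤ L * ((2 * |x| + 1) * (k + 1)) := by gcongr; nlinarith
      _ ≤ L * (exp ((2 : ℕ) * |x|) * (k + 1)) := by gcongr
      _ = _ := by ring
  have hcorr : (k : ℝ) * logCorrection L r ≤ s / L + s * |x| := by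
    have e : (k : ℝ) * logCorrection L r =
        r * logCorrection L r / L + x * logCorrection L r := by rw [hx]; field_simp; ring
    rw [e]
    have h1 : x * logCorrection L r ≤ |x| * s :=
      (mul_le_mul_of_nonneg_right (le_abs_self x) (logCorrection_nonneg L r)).trans
        (mul_le_mul_of_nonneg_left (logCorrection_le_exp_half hr) (abs_nonneg x))
    have h2 : r * logCorrection L r / L ≤ s / L := by
      gcongr; exact mul_logCorrection_le L r
    linarith
  have hlog : exp (-(k * log (k / (r / L)) - x)) ≤ 1 := by
    rw [exp_le_one_iff]
    have := sub_le_mul_log_div hk (div_pos hr hL)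
    linarith
  rw [scaledTerm_eq hL hr h]
  calc _ ≤ 1 * 1 * (√L * exp |x|) * exp (s / L + s * |x|) * 1 * exp (-(L / 2 * x ^ 2)) := by
        have := fallingRatio_nonneg n k
        have := stirlingRatio_nonneg k
        gcongr
        · exact fallingRatio_le_one hn k
        · exact stirlingRatio_le_one k
    _ = √L * exp (|x| + (s / L + s * |x|) + -(L / 2 * x ^ 2)) := by
        simp only [exp_add]; ring
    _ ≤ √L * exp (s / L + (2 + s) ^ 2 / (2 * L) + -|x|) := by
        gcongr √L * exp ?_
        have := mul_abs_sub_mul_sq_le hL (2 + s) x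
        linarith
    _ = _ := by rw [exp_add, mul_assoc]

theorem gaussian_le {L : ℝ} (hL : 0 < L) (x : ℝ) :
    √(L / (2 * π)) * exp (-(L / 2 * x ^ 2)) ≤
      √L * exp (exp (L / 2) / L + (2 + exp (L / 2)) ^ 2 / (2 * L)) * exp (-|x|) := by
  have h1 : √(L / (2 * π)) ≤ √L := by
    apply sqrt_le_sqrt
    exact div_le_self hL.le (by linarith [pi_gt_three])
  rw [mul_assoc, ← exp_add]
  gcongr
  have h2 := mul_abs_sub_mul_sq_le hL (2 + exp (L / 2)) x
  have h3 := abs_nonneg x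
  have h4 := exp_pos (L / 2)
  have h5 : 0 < exp (L / 2) / L := by positivity
  nlinarith

theorem tendsto_affine_pow_mul_exp_neg (a b : ℝ) :
    Tendsto (fun t : ℝ => (a * t + b) * exp (-t)) atTop (𝓝 0) ∧
      Tendsto (fun t : ℝ => (a * t + b) ^ 2 * exp (-t)) atTop (𝓝 0) := by
  have h0 := tendsto_pow_mul_exp_neg_atTop_nhds_zero 0
  have h1 := tendsto_pow_mul_exp_neg_atTop_nhds_zero 1
  have h2 := tendsto_pow_mul_exp_neg_atTop_nhds_zero 2
  constructor
  · have := (h1.const_mul a).add (h0.const_mul b)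
    simp only [mul_zero, add_zero] at this
    exact this.congr fun t => by ring
  · have := ((h2.const_mul (a ^ 2)).add (h1.const_mul (2 * a * b))).add (h0.const_mul (b ^ 2))
    simp only [mul_zero, add_zero] at this
    exact this.congr fun t => by ring

theorem tendsto_scaledTerm_sub_gaussian {L M : ℝ} (hL : 0 < L) {r : ℕ → ℝ} {κ : ℕ → ℕ}
    (hr : ∀ n : ℕ, 0 < n →
      0 < r n ∧ r n * (exp (r n) + exp (L / 2)) = n * exp (L / 2) * L)
    (hlim : Tendsto r atTop atTop) (hκ : ∀ᶠ n in atTop, |(κ n : ℝ) - r n / L| ≤ M) :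
    Tendsto (fun n => scaledTerm L (r n) n (κ n) -
      √(L / (2 * π)) * exp (-(L / 2 * (κ n - r n / L) ^ 2))) atTop (𝓝 0) := by
  have hc : Tendsto (fun n => r n / L) atTop atTop := hlim.atTop_div_const hL
  have hdiv : ∀ B : ℝ, Tendsto (fun n => B / (r n / L)) atTop (𝓝 0) := fun B =>
    tendsto_const_nhds.div_atTop hc
  have hκtop : Tendsto κ atTop atTop := by
    rw [← tendsto_natCast_atTop_iff (R := ℝ)]
    refine tendsto_atTop_mono' _ ?_ (tendsto_atTop_add_const_right _ (-M) hc)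
    filter_upwards [hκ] with n hn
    linarith [(abs_le.1 hn).1]
  have hev : ∀ᶠ n in atTop, 0 < n ∧ 0 < κ n ∧ 1 ≤ r n / L ∧ |(κ n : ℝ) - r n / L| ≤ M := by
    filter_upwards [eventually_gt_atTop 0, hκtop.eventually_gt_atTop 0,
      hc.eventually_ge_atTop 1, hκ] with n h1 h2 h3 h4 using ⟨h1, h2, h3, h4⟩
  have hfall : Tendsto (fun n => fallingRatio n (κ n)) atTop (𝓝 1) := by
    have hz := ((tendsto_affine_pow_mul_exp_neg L⁻¹ M).2.comp hlim).mul_const (exp (L / 2))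
    have hlow := hz.const_sub 1
    rw [zero_mul, sub_zero] at hlow
    refine tendsto_of_tendsto_of_tendsto_of_le_of_le' hlow tendsto_const_nhds ?_ ?_
    · filter_upwards [hev] with n ⟨hn, _, hc1, hM⟩
      refine le_trans ?_ (one_sub_sq_div_le_fallingRatio hn (κ n))
      have hnn : exp (r n - L / 2) ≤ n := by
        rw [eq_mul_exp_of_saddle_eq hL (hr n hn).2]
        have h1 : exp (r n - L / 2) ≤ exp (r n - L / 2 + logCorrection L (r n)) :=
          exp_le_exp.2 (by linarith [logCorrection_nonneg L (r n)])
        have h2 := exp_pos (r n - L / 2 + logCorrection L (r n))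
        nlinarith
      have hk : (κ n : ℝ) ≤ L⁻¹ * r n + M := by
        have := (abs_le.1 hM).2
        rw [div_eq_inv_mul] at this
        linarith
      have hle : (κ n : ℝ) ^ 2 / n ≤ (L⁻¹ * r n + M) ^ 2 / exp (r n - L / 2) := by
        gcongr
      have e : (L⁻¹ * r n + M) ^ 2 / exp (r n - L / 2) =
          (L⁻¹ * r n + M) ^ 2 * exp (-(r n)) * exp (L / 2) := by
        rw [div_eq_mul_inv, ← exp_neg, mul_assoc, ← exp_add]
        congr 2
        ring
      rw [e] at hle
      simp only [Function.comp_apply]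
      linarith
    · filter_upwards [hev] with n hn using fallingRatio_le_one hn.1 _
  have hroot : Tendsto (fun n => √(r n / (κ n + 1))) atTop (𝓝 √L) := by
    have hx : Tendsto (fun n => (κ n - r n / L + 1) / (r n / L)) atTop (𝓝 0) := by
      refine squeeze_zero_norm' ?_ (hdiv (M + 1))
      filter_upwards [hev] with n ⟨_, _, hc1, hM⟩
      rw [norm_eq_abs, abs_div, abs_of_pos (show 0 < r n / L by linarith)]
      gcongr
      exact (abs_add_le _ _).trans (by rw [abs_one]; linarith)
    have h1 := (tendsto_const_nhds (x := L)).div (hx.const_add 1) (by norm_num)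
    rw [add_zero, div_one] at h1
    refine (h1.congr' ?_).sqrt
    filter_upwards [hev] with n ⟨hn, _⟩
    have := (hr n hn).1
    have h3 : (0 : ℝ) < κ n + 1 := by positivity
    have e : 1 + (κ n - r n / L + 1) / (r n / L) = (κ n + 1) / (r n / L) := by
      field_simp
      ring
    simp only [Pi.div_apply]
    rw [e]
    field_simp
  have hcorr : Tendsto (fun n => exp (κ n * logCorrection L (r n))) atTop (𝓝 1) := by
    rw [← exp_zero]
    refine (continuous_exp.tendsto 0).comp ?_
    have hz := ((tendsto_affine_pow_mul_exp_neg L⁻¹ M).1.comp hlim).mul_const (exp (L / 2))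
    rw [zero_mul] at hz
    refine squeeze_zero' (Eventually.of_forall fun n =>
      mul_nonneg (Nat.cast_nonneg _) (logCorrection_nonneg _ _)) ?_ hz
    filter_upwards [hev] with n ⟨hn, _, hc1, hM⟩
    have hk : (κ n : ℝ) ≤ L⁻¹ * r n + M := by
      have := (abs_le.1 hM).2
      rw [div_eq_inv_mul] at this
      linarith
    have e : exp (L / 2 - r n) = exp (-(r n)) * exp (L / 2) := by
      rw [← exp_add]; congr 1; ring
    simp only [Function.comp_apply]
    rw [mul_assoc, ← e]
    exact mul_le_mul hk (logCorrection_le _ _) (logCorrection_nonneg _ _)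
      ((Nat.cast_nonneg _).trans hk)
  have hlog : Tendsto (fun n => exp (-(κ n * log (κ n / (r n / L)) - (κ n - r n / L))))
      atTop (𝓝 1) := by
    rw [← exp_zero, ← neg_zero]
    refine (continuous_exp.tendsto (-0)).comp (Tendsto.neg ?_)
    refine squeeze_zero' ?_ ?_ (hdiv (M ^ 2))
    · filter_upwards [hev] with n ⟨_, _, hc1, _⟩
      have := sub_le_mul_log_div (Nat.cast_nonneg (κ n)) (show 0 < r n / L by linarith)
      linarith
    · filter_upwards [hev] with n ⟨_, hk, hc1, hM⟩
      refine (mul_log_div_sub_le (by exact_mod_cast hk) (by linarith)).trans ?_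
      exact div_le_div_of_nonneg_right (sq_le_sq' (abs_le.1 hM).1 (abs_le.1 hM).2) (by linarith)
  have hprod := (((hfall.mul (tendsto_stirlingRatio.comp hκtop)).mul hroot).mul hcorr).mul hlog
  have hconst : 1 * (1 / √(2 * π)) * √L * 1 * 1 = √(L / (2 * π)) := by
    rw [sqrt_div hL.le]; ring
  rw [hconst] at hprod
  have hdiff := hprod.sub_const (√(L / (2 * π)))
  rw [sub_self] at hdiff
  have hbdd : IsBoundedUnder (· ≤ ·) atTop
      (norm ∘ fun n => exp (-(L / 2 * (κ n - r n / L) ^ 2))) :=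
    isBoundedUnder_of ⟨1, fun n => by
      simp only [Function.comp_apply]
      rw [norm_eq_abs, abs_exp, exp_le_one_iff]
      have : 0 ≤ L / 2 * (κ n - r n / L) ^ 2 := by positivity
      linarith⟩
  refine (hdiff.zero_mul_isBoundedUnder_le hbdd).congr' ?_
  filter_upwards [hev] with n ⟨hn, _⟩
  rw [scaledTerm_eq hL (hr n hn).1 (hr n hn).2]
  simp only [Function.comp_apply]
  ring

/-- The normalised summand extended by zero to the integers. -/
noncomputable def scaledTermInt (L r : ℝ) (n : ℕ) (m : ℤ) : ℝ :=
  if 0 ≤ m then scaledTerm L r n m.toNat else 0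

theorem sum_scaledTerm_eq_tsum (L r : ℝ) (n : ℕ) :
    ∑ k ∈ Finset.range (n + 1), scaledTerm L r n k = ∑' m : ℤ, scaledTermInt L r n m := by
  have h1 : ∑' k : ℕ, scaledTermInt L r n (k : ℤ) = ∑' m : ℤ, scaledTermInt L r n m := by
    refine Function.Injective.tsum_eq Nat.cast_injective fun m hm => ?_
    by_contra hm'
    apply hm
    rw [scaledTermInt, if_neg]
    exact fun h => hm' ⟨m.toNat, by simpa using h⟩
  rw [← h1, tsum_eq_sum (s := Finset.range (n + 1))]
  · exact Finset.sum_congr rfl fun k _ => by simp [scaledTermInt]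
  · intro k hk
    have : n < k := by simpa [Nat.lt_succ_iff] using hk
    simp [scaledTermInt, scaledTerm, Nat.choose_eq_zero_of_lt this]

theorem summable_exp_neg_abs_int : Summable fun j : ℤ => exp (-|(j : ℝ)|) := by
  refine Summable.of_nat_of_neg ?_ ?_ <;>
  simpa using summable_exp_neg_nat

theorem tendsto_sum_scaledTerm_sub_tsum_gaussian {L : ℝ} (hL : 0 < L) {r : ℕ → ℝ}
    (hr : ∀ n : ℕ, 0 < n →
      0 < r n ∧ r n * (exp (r n) + exp (L / 2)) = n * exp (L / 2) * L)
    (hlim : Tendsto r atTop atTop) :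
    Tendsto (fun n => ∑ k ∈ Finset.range (n + 1), scaledTerm L (r n) n k -
      √(L / (2 * π)) * ∑' m : ℤ, exp (-(L / 2 * (m - r n / L) ^ 2))) atTop (𝓝 0) := by
  set C := √L * exp (exp (L / 2) / L + (2 + exp (L / 2)) ^ 2 / (2 * L)) with hC
  set F : ℕ → ℤ → ℝ := fun n j => scaledTermInt L (r n) n (j + ⌊r n / L⌋) with hF
  set G : ℕ → ℤ → ℝ := fun n j =>
    √(L / (2 * π)) * exp (-(L / 2 * ((j + ⌊r n / L⌋ : ℤ) - r n / L) ^ 2)) with hG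
  have hgs : Summable fun j : ℤ => C * exp 1 * exp (-|(j : ℝ)|) :=
    summable_exp_neg_abs_int.mul_left _
  have hfloor : ∀ n (j : ℤ), |(((j + ⌊r n / L⌋ : ℤ) : ℝ) - r n / L) - j| ≤ 1 := fun n j => by
    rw [abs_le]
    push_cast
    constructor <;> linarith [Int.floor_le (r n / L), Int.lt_floor_add_one (r n / L)]
  have habs : ∀ n (j : ℤ), |(j : ℝ)| ≤ |((j + ⌊r n / L⌋ : ℤ) : ℝ) - r n / L| + 1 :=
    fun n j => by
      have := abs_sub_abs_le_abs_sub (j : ℝ) (((j + ⌊r n / L⌋ : ℤ) : ℝ) - r n / L)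
      rw [abs_sub_comm (j : ℝ)] at this
      linarith [hfloor n j]
  have hexp : ∀ n (j : ℤ), C * exp (-|((j + ⌊r n / L⌋ : ℤ) : ℝ) - r n / L|) ≤
      C * exp 1 * exp (-|(j : ℝ)|) := fun n j => by
    rw [mul_assoc C, ← exp_add]
    gcongr C * exp ?_
    linarith [habs n j]
  have hGb : ∀ n j, ‖G n j‖ ≤ C * exp 1 * exp (-|(j : ℝ)|) := fun n j => by
    rw [norm_of_nonneg (by positivity)]
    exact (gaussian_le hL _).trans (hexp n j)
  have hFb : ∀ n, 0 < n → ∀ j, ‖F n j‖ ≤ C * exp 1 * exp (-|(j : ℝ)|) := fun n hn j => by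
    simp only [hF, scaledTermInt]
    split_ifs with h
    · rw [norm_of_nonneg (scaledTerm_nonneg _ _ _ _)]
      refine (scaledTerm_le hn hL (hr n hn).1 (hr n hn).2 _).trans ?_
      have e : (((j + ⌊r n / L⌋).toNat : ℕ) : ℝ) = ((j + ⌊r n / L⌋ : ℤ) : ℝ) := by
        exact_mod_cast congrArg (Int.cast : ℤ → ℝ) (Int.toNat_of_nonneg h)
      rw [e]
      exact hexp n j
    · rw [norm_zero]
      positivity
  have hpoint : ∀ j : ℤ, Tendsto (fun n => F n j - G n j) atTop (𝓝 0) := fun j => by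
    have hpos : ∀ᶠ n in atTop, 0 ≤ j + ⌊r n / L⌋ := by
      have := (tendsto_floor_atTop.comp (hlim.atTop_div_const hL)).eventually_ge_atTop (-j)
      filter_upwards [this] with n hn
      simp only [Function.comp_apply] at hn
      omega
    have hcast : ∀ᶠ n in atTop,
        (((j + ⌊r n / L⌋).toNat : ℕ) : ℝ) = ((j + ⌊r n / L⌋ : ℤ) : ℝ) := by
      filter_upwards [hpos] with n h
      exact_mod_cast congrArg (Int.cast : ℤ → ℝ) (Int.toNat_of_nonneg h)
    have h := tendsto_scaledTerm_sub_gaussian (M := |(j : ℝ)| + 1)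
      (κ := fun n => (j + ⌊r n / L⌋).toNat) hL hr hlim (by
        filter_upwards [hcast] with n hn
        rw [hn]
        have := abs_sub_abs_le_abs_sub (((j + ⌊r n / L⌋ : ℤ) : ℝ) - r n / L) (j : ℝ)
        linarith [hfloor n j])
    refine h.congr' ?_
    filter_upwards [hpos, hcast] with n h1 h2
    simp only [hF, hG, scaledTermInt, if_pos h1, h2]
  have hdom := tendsto_tsum_of_dominated_convergence (f := fun n j => F n j - G n j)
    (hgs.add hgs) hpoint (by
      filter_upwards [eventually_gt_atTop 0] with n hn j
      exact (norm_sub_le _ _).trans (add_le_add (hFb n hn j) (hGb n j)))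
  rw [tsum_zero] at hdom
  refine hdom.congr' ?_
  filter_upwards [eventually_gt_atTop 0] with n hn
  rw [(hgs.of_norm_bounded (hFb n hn)).tsum_sub (hgs.of_norm_bounded (hGb n)),
    sum_scaledTerm_eq_tsum, ← tsum_mul_left,
    ← (Equiv.addRight ⌊r n / L⌋).tsum_eq (scaledTermInt L (r n) n),
    ← (Equiv.addRight ⌊r n / L⌋).tsum_eq
      fun m : ℤ => √(L / (2 * π)) * exp (-(L / 2 * (m - r n / L) ^ 2))]
  rfl

theorem tendsto_atTop_of_saddle_eq {L : ℝ} (hL : 0 < L) {r : ℕ → ℝ}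
    (hr : ∀ n : ℕ, 0 < n →
      0 < r n ∧ r n * (exp (r n) + exp (L / 2)) = n * exp (L / 2) * L) :
    Tendsto r atTop atTop := by
  have htop : Tendsto (fun n : ℕ => (n : ℝ) * (exp (L / 2) * L)) atTop atTop :=
    tendsto_natCast_atTop_atTop.atTop_mul_const (by positivity)
  refine tendsto_atTop.2 fun M => ?_
  filter_upwards [eventually_gt_atTop 0,
    htop.eventually_gt_atTop (M * (exp M + exp (L / 2)))] with n hn h
  by_contra! hlt
  obtain ⟨h0, heq⟩ := hr n hn
  have : r n * (exp (r n) + exp (L / 2)) ≤ M * (exp M + exp (L / 2)) := by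
    have hM : 0 < M := h0.trans hlt
    gcongr
  linarith

/-- Main theorem: for fixed `y > 1`, as `n → ∞`,
`f_n(1/y) √(r n) exp(−(r(n)² + 2 r(n))/(2 log y)) − Θ(n) → 0`, where
`Θ(n) = 1 + 2 ∑_{k=1}^∞ exp(−2π²k²/log y) cos(2πk r(n)/log y)`. -/
theorem main_asymptotics (y : ℝ) (hy : 1 < y) (r : ℕ → ℝ)
    (hr : ∀ n : ℕ, 0 < n →
      0 < r n ∧ r n * (Real.exp (r n) + Real.sqrt y) = n * Real.sqrt y * Real.log y) :
    Filter.Tendsto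
      (fun n : ℕ =>
        (∑ k ∈ Finset.range (n + 1), (n.choose k : ℝ) * (1 / y) ^ (k.choose 2)) *
            Real.sqrt (r n) * Real.exp (-((r n) ^ 2 + 2 * r n) / (2 * Real.log y)) -
          (1 + 2 * ∑' k : ℕ,
            Real.exp (-2 * Real.pi ^ 2 * ((k : ℝ) + 1) ^ 2 / Real.log y) *
              Real.cos (2 * Real.pi * ((k : ℝ) + 1) * r n / Real.log y)))
      Filter.atTop (nhds 0) := by
  obtain ⟨L, hL, rfl⟩ : ∃ L, 0 < L ∧ y = exp L :=
    ⟨log y, log_pos hy, (exp_log (by linarith)).symm⟩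
  have hsqrt : √(exp L) = exp (L / 2) := (exp_half L).symm
  simp only [log_exp, hsqrt] at hr ⊢
  refine (tendsto_sum_scaledTerm_sub_tsum_gaussian hL hr
    (tendsto_atTop_of_saddle_eq hL hr)).congr fun n => ?_
  rw [one_add_two_mul_tsum_exp_mul_cos hL, mul_assoc, Finset.sum_mul]
  congr 1
  refine Finset.sum_congr rfl fun k _ => ?_
  rw [scaledTerm, one_div, ← exp_neg, ← exp_nat_mul, Nat.cast_choose_two]
  congr 3
  ring
end

section
/- Let y > 1 be fixed, let r(n) be the unique positive solution t of t·(e^t + √y) = n·√y·log y, and let w(n) be the unique positive solution t of t·e^t = n·√y·log y (i.e. w(n) = W(n·√y·log y) with LambertW). Then, as n → ∞: w(n)/r(n) → 1, w(n) − r(n) → 0, and w(n)² − r(n)² → 0. -/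
open Filter Topology in
/-- If `r (e^r + s)` tends to infinity along a filter with `r` positive, then so does `r`. -/
theorem tendsto_atTop_of_mul_exp_add {ι : Type*} {l : Filter ι} {r : ι → ℝ} {s : ℝ} (hs : 0 ≤ s)
    (hr : ∀ᶠ i in l, 0 < r i)
    (h : Tendsto (fun i => r i * (Real.exp (r i) + s)) l atTop) : Tendsto r l atTop := by
  refine tendsto_atTop.2 fun b => ?_
  filter_upwards [hr, h.eventually_gt_atTop (b * (Real.exp b + s))] with i hi hlt
  by_contra! hb
  have : r i * (Real.exp (r i) + s) ≤ b * (Real.exp b + s) := by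
    have := Real.exp_pos (r i)
    gcongr
    linarith
  linarith

/-- If `w e^w = r (e^r + s)` with `r, w > 0` and `s ≥ 0`, then `r ≤ w`. -/
theorem le_of_mul_exp_eq {r w s : ℝ} (hr : 0 < r) (hs : 0 ≤ s)
    (h : w * Real.exp w = r * (Real.exp r + s)) : r ≤ w := by
  by_contra! hlt
  have : w * Real.exp w < r * Real.exp r :=
    mul_lt_mul hlt (Real.exp_le_exp.2 hlt.le) (Real.exp_pos w) hr.le
  nlinarith [mul_nonneg hr.le hs]

/-- If `w e^w = r (e^r + s)` with `r > 0` and `s ≥ 0`, then `w - r ≤ s e^{-r}`. -/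
theorem sub_le_mul_exp_neg_of_mul_exp_eq {r w s : ℝ} (hr : 0 < r) (hs : 0 ≤ s)
    (h : w * Real.exp w = r * (Real.exp r + s)) : w - r ≤ s * Real.exp (-r) := by
  have hle := le_of_mul_exp_eq hr hs h
  have hexp : Real.exp r * (w - r + 1) ≤ Real.exp w := by
    calc Real.exp r * (w - r + 1) ≤ Real.exp r * Real.exp (w - r) := by
          gcongr
          exact Real.add_one_le_exp _
      _ = Real.exp w := by rw [← Real.exp_add, add_sub_cancel]
  have hmul : r * (Real.exp r * (w - r)) ≤ r * s := by
    nlinarith [mul_le_mul_of_nonneg_left hexp hr.le,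
      mul_le_mul_of_nonneg_right hle (Real.exp_pos w).le]
  rw [Real.exp_neg, ← div_eq_mul_inv, le_div_iff₀ (Real.exp_pos r), mul_comm]
  exact le_of_mul_le_mul_left hmul hr

/-- Comparison of `w(n) = W(n √y log y)` and `r(n)`: as `n → ∞`, `w(n)/r(n) → 1`,
`w(n) − r(n) → 0`, and `w(n)² − r(n)² → 0`. -/
theorem w_r_comparison (y : ℝ) (hy : 1 < y) (r w : ℕ → ℝ)
    (hr : ∀ n : ℕ, 0 < n →
      0 < r n ∧ r n * (Real.exp (r n) + Real.sqrt y) = n * Real.sqrt y * Real.log y)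
    (hw : ∀ n : ℕ, 0 < n →
      0 < w n ∧ w n * Real.exp (w n) = n * Real.sqrt y * Real.log y) :
    Filter.Tendsto (fun n : ℕ => w n / r n) Filter.atTop (nhds 1) ∧
    Filter.Tendsto (fun n : ℕ => w n - r n) Filter.atTop (nhds 0) ∧
    Filter.Tendsto (fun n : ℕ => (w n) ^ 2 - (r n) ^ 2) Filter.atTop (nhds 0) := by
  have hs : 0 < Real.sqrt y := Real.sqrt_pos.2 (by linarith)
  have hr_pos : ∀ᶠ n in Filter.atTop, 0 < r n := by
    filter_upwards [Filter.eventually_gt_atTop 0] with n hn using (hr n hn).1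
  have hr_top : Filter.Tendsto r Filter.atTop Filter.atTop := by
    refine tendsto_atTop_of_mul_exp_add hs.le hr_pos ?_
    have hlin : Filter.Tendsto (fun n : ℕ => (n : ℝ) * Real.sqrt y * Real.log y)
        Filter.atTop Filter.atTop :=
      (tendsto_natCast_atTop_atTop.atTop_mul_const hs).atTop_mul_const (Real.log_pos hy)
    refine hlin.congr' ?_
    filter_upwards [Filter.eventually_gt_atTop 0] with n hn using (hr n hn).2.symm
  have hbounds : ∀ᶠ n in Filter.atTop,
      0 ≤ w n - r n ∧ w n - r n ≤ Real.sqrt y * Real.exp (-r n) := by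
    filter_upwards [Filter.eventually_gt_atTop 0] with n hn
    have h := (hw n hn).2.trans (hr n hn).2.symm
    exact ⟨sub_nonneg.2 (le_of_mul_exp_eq (hr n hn).1 hs.le h),
      sub_le_mul_exp_neg_of_mul_exp_eq (hr n hn).1 hs.le h⟩
  have hsub : Filter.Tendsto (fun n => w n - r n) Filter.atTop (nhds 0) := by
    have hexp := (Real.tendsto_exp_neg_atTop_nhds_zero.comp hr_top).const_mul (Real.sqrt y)
    rw [mul_zero] at hexp
    exact squeeze_zero' (hbounds.mono fun _ h => h.1) (hbounds.mono fun _ h => h.2) hexp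
  have hmul : Filter.Tendsto (fun n => r n * (w n - r n)) Filter.atTop (nhds 0) := by
    have hexp := ((Real.tendsto_pow_mul_exp_neg_atTop_nhds_zero 1).comp hr_top).const_mul
      (Real.sqrt y)
    rw [mul_zero] at hexp
    refine squeeze_zero' ?_ ?_ hexp
    · filter_upwards [hr_pos, hbounds] with n hn h using mul_nonneg hn.le h.1
    · filter_upwards [hr_pos, hbounds] with n hn h
      calc r n * (w n - r n) ≤ r n * (Real.sqrt y * Real.exp (-r n)) := by
            gcongr
            exact h.2
        _ = _ := by simp only [Function.comp_apply, pow_one]; ring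
  refine ⟨?_, hsub, ?_⟩
  · have h := (hsub.div_atTop hr_top).add_const 1
    rw [zero_add] at h
    refine h.congr' ?_
    filter_upwards [hr_pos] with n hn
    field_simp
    ring
  · have h := (hsub.pow 2).add (hmul.const_mul 2)
    norm_num at h
    exact h.congr fun n => by ring
end

section
/- For a fixed real number y > 1, log f_n(1/y) ~ (log n)²/(2·log y) as n → ∞, i.e. the quotient of the two sides tends to 1. -/
theorem pow_le_pow_mul_pow_mul_choose {n k : ℕ} (hk : 1 ≤ k) (hkn : k ≤ n) :
    (n : ℝ) ^ k ≤ (k : ℝ) ^ k * (k : ℝ) ^ k * n.choose k := by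
  have h1 : n ≤ k * (n + 1 - k) := by
    obtain ⟨m, rfl⟩ := Nat.exists_eq_add_of_le hkn
    rw [show k + m + 1 - k = m + 1 by omega]
    nlinarith
  have h2 : (n + 1 - k) ^ k ≤ k ^ k * n.choose k :=
    calc (n + 1 - k) ^ k ≤ n.descFactorial k := n.pow_sub_le_descFactorial k
      _ = k.factorial * n.choose k := Nat.descFactorial_eq_factorial_mul_choose n k
      _ ≤ k ^ k * n.choose k := Nat.mul_le_mul_right _ k.factorial_le_pow
  have h3 : n ^ k ≤ k ^ k * k ^ k * n.choose k :=
    calc n ^ k ≤ (k * (n + 1 - k)) ^ k := Nat.pow_le_pow_left h1 k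
      _ = k ^ k * (n + 1 - k) ^ k := mul_pow _ _ _
      _ ≤ k ^ k * (k ^ k * n.choose k) := Nat.mul_le_mul_left _ h2
      _ = k ^ k * k ^ k * n.choose k := (mul_assoc _ _ _).symm
  exact_mod_cast h3

theorem one_div_pow_choose_two_eq_exp {y : ℝ} (hy : 0 < y) (k : ℕ) :
    (1 / y) ^ (k.choose 2) = Real.exp (-(Real.log y * (k * (k - 1) / 2))) := by
  rw [← Nat.cast_choose_two, ← Real.exp_log (pow_pos (one_div_pos.2 hy) _), Real.log_pow,
    one_div, Real.log_inv]
  ring_nf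

theorem sum_choose_mul_pos (n : ℕ) {y : ℝ} (hy : 0 < y) :
    0 < ∑ k ∈ Finset.range (n + 1), (n.choose k : ℝ) * (1 / y) ^ (k.choose 2) := by
  refine Finset.sum_pos (fun k hk => ?_) ⟨0, by simp⟩
  have : 0 < n.choose k := Nat.choose_pos (Nat.lt_succ_iff.1 (Finset.mem_range.1 hk))
  positivity

theorem log_sum_choose_mul_le {n : ℕ} (hn : 1 ≤ n) {y : ℝ} (hy : 1 < y) :
    Real.log (∑ k ∈ Finset.range (n + 1), (n.choose k : ℝ) * (1 / y) ^ (k.choose 2)) ≤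
      1 + (Real.log n + Real.log y / 2) ^ 2 / (2 * Real.log y) := by
  have hc : 0 < Real.log y := Real.log_pos hy
  have hn0 : (0 : ℝ) < n := by exact_mod_cast hn
  rw [Real.log_le_iff_le_exp (sum_choose_mul_pos n (by linarith)), Real.exp_add]
  set E := Real.exp ((Real.log n + Real.log y / 2) ^ 2 / (2 * Real.log y)) with hE
  calc _ ≤ ∑ k ∈ Finset.range (n + 1), (1 : ℝ) ^ k / k.factorial * E := by
        refine Finset.sum_le_sum fun k _ => ?_
        rw [one_div_pow_choose_two_eq_exp (by linarith)]
        calc _ ≤ (n : ℝ) ^ k / k.factorial * Real.exp (-(Real.log y * (k * (k - 1) / 2))) := by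
              gcongr
              exact Nat.choose_le_pow_div k n
          _ = 1 ^ k / k.factorial *
              Real.exp (k * Real.log n + -(Real.log y * (k * (k - 1) / 2))) := by
              rw [Real.exp_add, ← Real.log_pow, Real.exp_log (pow_pos hn0 k)]
              ring
          _ ≤ _ := by
              rw [hE]
              gcongr
              rw [le_div_iff₀ (by positivity)]
              nlinarith [sq_nonneg (Real.log n + Real.log y / 2 - Real.log y * k)]
    _ = (∑ k ∈ Finset.range (n + 1), (1 : ℝ) ^ k / k.factorial) * E := by
        rw [Finset.sum_mul]
    _ ≤ _ := by
        gcongr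
        exact Real.sum_le_exp_of_nonneg zero_le_one _

theorem le_log_sum_choose_mul {n : ℕ} {y : ℝ} (hy : 1 < y) (hle : Real.log y ≤ Real.log n)
    (hn : Real.log n ≤ Real.log y * n) :
    Real.log n ^ 2 / (2 * Real.log y) - Real.log y / 2 -
        2 * (Real.log n / Real.log y) * Real.log (Real.log n / Real.log y) ≤
      Real.log (∑ k ∈ Finset.range (n + 1), (n.choose k : ℝ) * (1 / y) ^ (k.choose 2)) := by
  have hy0 : 0 < y := by linarith
  have hc : 0 < Real.log y := Real.log_pos hy
  have hn0 : (0 : ℝ) < n := by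
    by_contra h
    have : (n : ℝ) = 0 := le_antisymm (not_lt.1 h) n.cast_nonneg
    simp only [this, Real.log_zero] at hle
    linarith
  set u := Real.log n / Real.log y with hu
  have hLu : Real.log n = Real.log y * u := by rw [hu]; field_simp
  have hu1 : 1 ≤ u := (one_le_div hc).2 hle
  have hun : u ≤ n := (div_le_iff₀' hc).2 hn
  set k := ⌊u⌋₊ with hk
  have hk1 : 1 ≤ k := Nat.one_le_floor_iff _ |>.2 hu1
  have hku : (k : ℝ) ≤ u := Nat.floor_le (by linarith)
  have huk : u < k + 1 := Nat.lt_floor_add_one u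
  have hkn : k ≤ n := by exact_mod_cast hku.trans hun
  have hk1' : (1 : ℝ) ≤ k := by exact_mod_cast hk1
  have hch : (0 : ℝ) < n.choose k := by exact_mod_cast Nat.choose_pos hkn
  have hterm : Real.log ((n.choose k : ℝ) * (1 / y) ^ (k.choose 2)) ≤
      Real.log (∑ k ∈ Finset.range (n + 1), (n.choose k : ℝ) * (1 / y) ^ (k.choose 2)) := by
    refine Real.log_le_log (by positivity) ?_
    exact Finset.single_le_sum
      (f := fun k : ℕ => (n.choose k : ℝ) * (1 / y) ^ (k.choose 2))
      (fun i _ => by positivity) (Finset.mem_range.2 (Nat.lt_succ_of_le hkn))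
  refine le_trans ?_ hterm
  rw [one_div_pow_choose_two_eq_exp hy0, Real.log_mul hch.ne' (Real.exp_ne_zero _), Real.log_exp]
  have hlog := Real.log_le_log (by positivity) (pow_le_pow_mul_pow_mul_choose hk1 hkn)
  rw [Real.log_mul (by positivity) (by positivity), Real.log_mul (by positivity) (by positivity),
    Real.log_pow, Real.log_pow] at hlog
  have hlk : (k : ℝ) * Real.log k ≤ u * Real.log u :=
    mul_le_mul hku (Real.log_le_log (by linarith) hku) (Real.log_nonneg hk1') (by linarith)
  have hsq : (u - k) ^ 2 ≤ 1 := by nlinarith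
  have hL2 : Real.log n ^ 2 / (2 * Real.log y) = Real.log y * u ^ 2 / 2 := by
    rw [hLu]; field_simp
  rw [hL2]
  rw [hLu] at hlog
  nlinarith [mul_le_mul_of_nonneg_left hsq hc.le, mul_pos hc (zero_lt_one.trans_le hk1')]

/-- Logarithmic asymptotics: for fixed `y > 1`,
`log f_n(1/y) ~ (log n)²/(2 log y)` as `n → ∞`. -/
theorem log_fn_asymptotic (y : ℝ) (hy : 1 < y) :
    Filter.Tendsto
      (fun n : ℕ =>
        Real.log (∑ k ∈ Finset.range (n + 1), (n.choose k : ℝ) * (1 / y) ^ (k.choose 2)) /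
          ((Real.log n) ^ 2 / (2 * Real.log y)))
      Filter.atTop (nhds 1) := by
  have hc : 0 < Real.log y := Real.log_pos hy
  set c := Real.log y with hcdef
  have hL : Filter.Tendsto (fun n : ℕ => Real.log n) Filter.atTop Filter.atTop :=
    Real.tendsto_log_atTop.comp tendsto_natCast_atTop_atTop
  have hinv : Filter.Tendsto (fun n : ℕ => (Real.log n)⁻¹) Filter.atTop (nhds 0) :=
    tendsto_inv_atTop_zero.comp hL
  have hlogdiv : Filter.Tendsto (fun x : ℝ => Real.log x / x) Filter.atTop (nhds 0) := by
    simpa using Real.tendsto_pow_log_div_mul_add_atTop 1 0 1 one_ne_zero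
  have hloglog : Filter.Tendsto
      (fun n : ℕ => Real.log (Real.log n / c) / (Real.log n / c)) Filter.atTop (nhds 0) :=
    hlogdiv.comp (hL.atTop_div_const hc)
  have hlow : Filter.Tendsto (fun n : ℕ => 1 - c ^ 2 * (Real.log n)⁻¹ ^ 2 -
      4 / c * (Real.log (Real.log n / c) / (Real.log n / c))) Filter.atTop (nhds 1) := by
    simpa using (((hinv.pow 2).const_mul (c ^ 2)).const_sub 1).sub (hloglog.const_mul (4 / c))
  have hupp : Filter.Tendsto (fun n : ℕ => 2 * c * (Real.log n)⁻¹ ^ 2 +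
      (1 + c / 2 * (Real.log n)⁻¹) ^ 2) Filter.atTop (nhds 1) := by
    simpa using ((hinv.pow 2).const_mul (2 * c)).add (((hinv.const_mul (c / 2)).const_add 1).pow 2)
  have hlin : ∀ᶠ n : ℕ in Filter.atTop, Real.log n ≤ c * n := by
    filter_upwards [(hlogdiv.comp tendsto_natCast_atTop_atTop).eventually (gt_mem_nhds hc),
      Filter.eventually_gt_atTop 0] with n hn hn0
    exact ((div_lt_iff₀ (by exact_mod_cast hn0)).1 hn).le
  refine tendsto_of_tendsto_of_tendsto_of_le_of_le' hlow hupp ?_ ?_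
  · filter_upwards [hlin, hL.eventually_ge_atTop c] with n hn hcn
    have hLpos : 0 < Real.log n := hc.trans_le hcn
    rw [le_div_iff₀ (by positivity)]
    refine le_trans (le_of_eq ?_) (le_log_sum_choose_mul hy hcn hn)
    rw [← hcdef]
    field_simp
    ring
  · filter_upwards [hL.eventually_gt_atTop 0, Filter.eventually_ge_atTop 1] with n hLpos hn
    rw [div_le_iff₀ (by positivity)]
    refine (log_sum_choose_mul_le hn hy).trans (le_of_eq ?_)
    rw [← hcdef]
    field_simp
end

section
/- Let y > 1 be a real number. Then the sequence (f_n(1/y))_{n=0}^{∞} is absolutely monotonic: for all nonnegative integers r and n, Δ^r f_n(1/y) ≥ 0, where Δ is the forward difference operator in n. Moreover, Δ^r f_n(1/y) = Σ_{k=0}^{n} C(n,k) · y^{−C(k+r,2)}. -/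
/-- The forward difference of a binomial transform is the binomial transform of the shifted
sequence. -/
theorem sum_range_choose_mul_succ_sub {R : Type*} [CommRing R] (a : ℕ → R) (n : ℕ) :
    ∑ k ∈ Finset.range (n + 1 + 1), ((n + 1).choose k : R) * a k -
        ∑ k ∈ Finset.range (n + 1), (n.choose k : R) * a k =
      ∑ k ∈ Finset.range (n + 1), (n.choose k : R) * a (k + 1) := by
  have h : ∑ k ∈ Finset.range (n + 1), (n.choose k : R) * a k =
      ∑ k ∈ Finset.range (n + 1), (n.choose (k + 1) : R) * a (k + 1) + a 0 := by
    have h₁ := Finset.sum_range_succ (fun k ↦ (n.choose k : R) * a k) (n + 1)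
    rw [Finset.sum_range_succ'] at h₁
    simpa using h₁.symm
  rw [h, Finset.sum_range_succ']
  simp only [Nat.choose_succ_succ', Nat.cast_add, add_mul, Finset.sum_add_distrib,
    Nat.choose_zero_right, Nat.cast_one, one_mul]
  ring

/-- Absolute monotonicity: for `y > 1` the sequence `(f_n(1/y))` satisfies `Δ^r f_n(1/y) ≥ 0`
for all nonnegative integers `r, n`, and moreover
`Δ^r f_n(1/y) = ∑_{k=0}^n C(n,k) y^{−C(k+r,2)}`. -/
theorem fn_absolutely_monotonic (y : ℝ) (hy : 1 < y) (F : ℕ → ℝ)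
    (hF : ∀ n : ℕ, F n = ∑ k ∈ Finset.range (n + 1), (n.choose k : ℝ) * (1 / y) ^ (k.choose 2))
    (Δ : (ℕ → ℝ) → (ℕ → ℝ)) (hΔ : ∀ (g : ℕ → ℝ) (n : ℕ), Δ g n = g (n + 1) - g n) :
    ∀ r n : ℕ, 0 ≤ (Δ^[r] F) n ∧
      (Δ^[r] F) n = ∑ k ∈ Finset.range (n + 1),
        (n.choose k : ℝ) * y ^ (-(((k + r).choose 2 : ℕ) : ℤ)) := by
  have formula : ∀ r n : ℕ, (Δ^[r] F) n = ∑ k ∈ Finset.range (n + 1),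
      (n.choose k : ℝ) * y ^ (-(((k + r).choose 2 : ℕ) : ℤ)) := by
    intro r
    induction r with
    | zero =>
      intro n
      simp [hF]
    | succ r ih =>
      intro n
      rw [Function.iterate_succ_apply', hΔ, ih, ih,
        sum_range_choose_mul_succ_sub (fun k ↦ y ^ (-(((k + r).choose 2 : ℕ) : ℤ)))]
      simp only [add_right_comm, add_assoc]
  refine fun r n ↦ ⟨?_, formula r n⟩
  rw [formula]
  positivity
end
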